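/- Let f : ℝ^d → ℝ be differentiable and m-strongly convex for some m > 0, with global minimizer θ̃ ∈ ℝ^d, and let θ̂ ∈ ℝ^d satisfy ‖∇f(θ̂)‖ ≤ β for some β ≥ 0. Let ρ > 0 and set σ = β/(m√(2ρ)) (with β > 0). For μ ∈ ℝ and σ > 0, let φ_{μ,σ}(x) = (1/(σ√(2π))) · exp(−(x−μ)²/(2σ²)). Then for every real α > 1, ∫_{ℝ^d} (∏_{i=1}^d φ_{θ̂ᵢ,σ}(x_i))^α · (∏_{i=1}^d φ_{θ̃ᵢ,σ}(x_i))^{1−α} dx ≤ exp(α(α−1)ρ); that is, the α-Rényi divergence between N(θ̂, σ²I_d) and N(θ̃, σ²I_d) is at most ρα for all α > 1. -/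

import Mathlib

open MeasureTheory Real Finset

/-- Density of the one-dimensional Gaussian distribution `N(μ, σ²)`. -/
noncomputable def gaussPdf (μ σ x : ℝ) : ℝ :=
  (1 / (σ * Real.sqrt (2 * π))) * Real.exp (-(x - μ) ^ 2 / (2 * σ ^ 2))

/-- The gradient of an `m`-strongly convex function is `m`-strongly monotone, here between a
critical point `x` and an arbitrary point `y`. -/
lemma strong_convex_inner_gradient_le {E : Type*} [NormedAddCommGroup E] [InnerProductSpace ℝ E]
    [CompleteSpace E] {f : E → ℝ} {m : ℝ} (hf : Differentiable ℝ f)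
    (hconv : ConvexOn ℝ Set.univ (fun θ => f θ - m / 2 * ‖θ‖ ^ 2))
    {x : E} (hx : gradient f x = 0) (y : E) :
    m * ‖y - x‖ ^ 2 ≤ inner ℝ (gradient f y) (y - x) := by
  have hline : ConvexOn ℝ Set.univ
      (fun t : ℝ => f (AffineMap.lineMap x y t) - m / 2 * ‖AffineMap.lineMap x y t‖ ^ 2) :=
    hconv.comp_affineMap (AffineMap.lineMap x y)
  have hderiv (t : ℝ) : HasDerivAt
      (fun t : ℝ => f (AffineMap.lineMap x y t) - m / 2 * ‖AffineMap.lineMap x y t‖ ^ 2)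
      (inner ℝ (gradient f (AffineMap.lineMap x y t)) (y - x) -
        m / 2 * (2 * inner ℝ (AffineMap.lineMap x y t) (y - x))) t := by
    have hl : HasDerivAt (fun t : ℝ => (AffineMap.lineMap x y t : E)) (y - x) t :=
      AffineMap.hasDerivAt_lineMap
    have h := (hf (AffineMap.lineMap x y t)).hasGradientAt.hasFDerivAt.comp_hasDerivAt t hl
    rw [InnerProductSpace.toDual_apply_apply] at h
    exact h.sub (hl.norm_sq.const_mul _)
  have h0 := hline.le_slope_of_hasDerivAt (Set.mem_univ 0) (Set.mem_univ 1) one_pos (hderiv 0)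
  have h1 := hline.slope_le_of_hasDerivAt (Set.mem_univ 0) (Set.mem_univ 1) one_pos (hderiv 1)
  have h := h0.trans h1
  simp only [AffineMap.lineMap_apply_zero, AffineMap.lineMap_apply_one, hx, inner_zero_left] at h
  have hn : ‖y - x‖ ^ 2 = inner ℝ y (y - x) - inner ℝ x (y - x) := by
    rw [← inner_sub_left, real_inner_self_eq_norm_sq]
  rw [hn]
  linarith

lemma strong_convex_norm_sub_le {E : Type*} [NormedAddCommGroup E] [InnerProductSpace ℝ E]
    [CompleteSpace E] {f : E → ℝ} {m : ℝ} (hf : Differentiable ℝ f)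
    (hconv : ConvexOn ℝ Set.univ (fun θ => f θ - m / 2 * ‖θ‖ ^ 2))
    {x : E} (hx : gradient f x = 0) (y : E) :
    m * ‖y - x‖ ≤ ‖gradient f y‖ := by
  have h := (strong_convex_inner_gradient_le hf hconv hx y).trans (real_inner_le_norm _ _)
  rcases (norm_nonneg (y - x)).eq_or_lt with h0 | h0
  · simp [← h0]
  · exact le_of_mul_le_mul_right (by rwa [mul_assoc, ← sq]) h0

lemma gaussPdf_eq_gaussianPDFReal (μ : ℝ) {σ : ℝ} (hσ : 0 < σ) :
    gaussPdf μ σ = ProbabilityTheory.gaussianPDFReal μ (σ ^ 2).toNNReal := by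
  ext x
  rw [gaussPdf, ProbabilityTheory.gaussianPDFReal, Real.coe_toNNReal _ (sq_nonneg σ),
    mul_comm (2 * π), Real.sqrt_mul (sq_nonneg σ), Real.sqrt_sq hσ.le, one_div]

lemma integral_gaussPdf (μ : ℝ) {σ : ℝ} (hσ : 0 < σ) : ∫ x, gaussPdf μ σ x = 1 := by
  rw [gaussPdf_eq_gaussianPDFReal μ hσ]
  exact ProbabilityTheory.integral_gaussianPDFReal_eq_one μ (by simpa using hσ.ne')

lemma gaussPdf_pos (μ : ℝ) {σ : ℝ} (hσ : 0 < σ) (x : ℝ) : 0 < gaussPdf μ σ x := by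
  unfold gaussPdf
  positivity

lemma gaussPdf_rpow_mul_rpow (a b : ℝ) {σ : ℝ} (hσ : 0 < σ) (α x : ℝ) :
    gaussPdf a σ x ^ α * gaussPdf b σ x ^ (1 - α) =
      Real.exp (α * (α - 1) * ((a - b) ^ 2 / (2 * σ ^ 2))) *
        gaussPdf (α * a + (1 - α) * b) σ x := by
  have hK : 0 < 1 / (σ * Real.sqrt (2 * π)) := by positivity
  unfold gaussPdf
  rw [Real.mul_rpow hK.le (Real.exp_pos _).le, Real.mul_rpow hK.le (Real.exp_pos _).le,
    ← Real.exp_mul, ← Real.exp_mul, mul_mul_mul_comm, ← Real.rpow_add hK, ← Real.exp_add,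
    mul_left_comm, ← Real.exp_add, add_sub_cancel, Real.rpow_one]
  congr 2
  field_simp
  ring

/-- The Rényi integral of two isotropic Gaussians with common variance. -/
lemma integral_prod_gaussPdf_rpow {d : ℕ} (a b : EuclideanSpace ℝ (Fin d)) {σ : ℝ} (hσ : 0 < σ)
    (α : ℝ) :
    (∫ x : EuclideanSpace ℝ (Fin d),
        (∏ i, gaussPdf (a i) σ (x i)) ^ α * (∏ i, gaussPdf (b i) σ (x i)) ^ (1 - α)) =
      Real.exp (α * (α - 1) * (‖a - b‖ ^ 2 / (2 * σ ^ 2))) := by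
  have hpt (x : EuclideanSpace ℝ (Fin d)) :
      (∏ i, gaussPdf (a i) σ (x i)) ^ α * (∏ i, gaussPdf (b i) σ (x i)) ^ (1 - α) =
        ∏ i, Real.exp (α * (α - 1) * ((a i - b i) ^ 2 / (2 * σ ^ 2))) *
          gaussPdf (α * a i + (1 - α) * b i) σ (x.ofLp i) := by
    rw [← Real.finsetProd_rpow _ _ fun i _ => (gaussPdf_pos _ hσ _).le,
      ← Real.finsetProd_rpow _ _ fun i _ => (gaussPdf_pos _ hσ _).le, ← Finset.prod_mul_distrib]
    exact Finset.prod_congr rfl fun i _ => gaussPdf_rpow_mul_rpow _ _ hσ _ _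
  simp_rw [hpt]
  rw [(PiLp.volume_preserving_ofLp (Fin d)).integral_comp
    (MeasurableEquiv.toLp 2 (Fin d → ℝ)).symm.measurableEmbedding
    (fun x : Fin d → ℝ => ∏ i, Real.exp (α * (α - 1) * ((a i - b i) ^ 2 / (2 * σ ^ 2))) *
      gaussPdf (α * a i + (1 - α) * b i) σ (x i)),
    integral_fintype_prod_volume_eq_prod (fun i t =>
      Real.exp (α * (α - 1) * ((a i - b i) ^ 2 / (2 * σ ^ 2))) *
        gaussPdf (α * a i + (1 - α) * b i) σ t)]
  simp_rw [integral_const_mul, integral_gaussPdf _ hσ, mul_one]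
  rw [← Real.exp_sum, ← Finset.mul_sum, ← Finset.sum_div, EuclideanSpace.real_norm_sq_eq]
  simp

/-- Core privacy step of PP-ADMM: if `θ̂` approximately minimizes an `m`-strongly
convex differentiable `f` (gradient norm at most `β`) with exact minimizer `θ̃`, and
`σ = β/(m√(2ρ))`, then the α-Rényi divergence between `N(θ̂, σ²I_d)` and
`N(θ̃, σ²I_d)` is at most `ρα` for all `α > 1`. -/
theorem pp_admm_release_zcdp {d : ℕ} (f : EuclideanSpace ℝ (Fin d) → ℝ) (m : ℝ)
    (hm : 0 < m) (hdiff : Differentiable ℝ f)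
    (hconv : ConvexOn ℝ Set.univ (fun θ => f θ - m / 2 * ‖θ‖ ^ 2))
    (θtil : EuclideanSpace ℝ (Fin d)) (hmin : ∀ θ, f θtil ≤ f θ)
    (θhat : EuclideanSpace ℝ (Fin d)) (β : ℝ) (hβ : 0 < β)
    (hgrad : ‖gradient f θhat‖ ≤ β)
    (ρ : ℝ) (hρ : 0 < ρ) (σ : ℝ) (hσ : σ = β / (m * Real.sqrt (2 * ρ)))
    (α : ℝ) (hα : 1 < α) :
    (∫ x : EuclideanSpace ℝ (Fin d),
        (∏ i, gaussPdf (θhat i) σ (x i)) ^ α * (∏ i, gaussPdf (θtil i) σ (x i)) ^ (1 - α)) ≤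
      Real.exp (α * (α - 1) * ρ) := by
  have hσ0 : 0 < σ := by rw [hσ]; positivity
  have hcrit : gradient f θtil = 0 := by
    have hloc : IsLocalMin f θtil := Filter.Eventually.of_forall hmin
    simp [gradient, hloc.fderiv_eq_zero]
  have hdist : m * ‖θhat - θtil‖ ≤ β :=
    (strong_convex_norm_sub_le hdiff hconv hcrit θhat).trans hgrad
  have hvar : 2 * σ ^ 2 * ρ = (β / m) ^ 2 := by
    rw [hσ, div_pow, mul_pow, Real.sq_sqrt (by positivity)]
    field_simp
  rw [integral_prod_gaussPdf_rpow θhat θtil hσ0 α]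
  refine Real.exp_le_exp.2 (mul_le_mul_of_nonneg_left ?_ (by nlinarith))
  rw [div_le_iff₀' (by positivity), hvar]
  gcongr
  rwa [le_div_iff₀' hm]
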